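/- Let ℏ > 0, let W_ℏ(x,p) = (2/ℏ)ⁿ e^{-(|x|²+|p|²)/ℏ}, and let f : ℝⁿ × ℝⁿ → ℝ be a Schwartz function with f ≥ 0 pointwise. Then the smeared (positive) quantization Q_ℏ^Ω(f) := Q_ℏ(W_ℏ * f), where (W_ℏ * f)(z) = ∫_{ℝ²ⁿ} W_ℏ(z − w) f(w) dw is convolution on ℝ²ⁿ and Q_ℏ is given by the Weyl kernel formula, is a positive operator on L²(ℝⁿ): ⟨Q_ℏ(W_ℏ * f)ψ, ψ⟩ ≥ 0 for every ψ ∈ L²(ℝⁿ). -/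

import Mathlib

open MeasureTheory

open scoped ComplexConjugate

/-- The Gaussian Wigner function `W_ℏ(x,p) = (2/ℏ)ⁿ e^{-(|x|²+|p|²)/ℏ}` on phase space. -/
noncomputable def gaussianWigner (n : ℕ) (ℏ : ℝ)
    (z : EuclideanSpace ℝ (Fin n) × EuclideanSpace ℝ (Fin n)) : ℝ :=
  (2 / ℏ) ^ n * Real.exp (-(‖z.1‖ ^ 2 + ‖z.2‖ ^ 2) / ℏ)

/-- Convolution on phase space `ℝ²ⁿ`: `(W ∗ f)(z) = ∫ W(z − w) f(w) dw`. -/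
noncomputable def phaseConv {n : ℕ}
    (W f : EuclideanSpace ℝ (Fin n) × EuclideanSpace ℝ (Fin n) → ℝ)
    (z : EuclideanSpace ℝ (Fin n) × EuclideanSpace ℝ (Fin n)) : ℝ :=
  ∫ w : EuclideanSpace ℝ (Fin n) × EuclideanSpace ℝ (Fin n), W (z - w) * f w

/-- The partial Fourier transform (in the momentum variable) of a phase-space
function `g`: `ǧ(x, ẋ) = (2π)^{-n} ∫ e^{i p·ẋ} g(x,p) dⁿp`. -/
noncomputable def partialFourier {n : ℕ}
    (g : EuclideanSpace ℝ (Fin n) × EuclideanSpace ℝ (Fin n) → ℝ)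
    (x v : EuclideanSpace ℝ (Fin n)) : ℂ :=
  (((2 * Real.pi) ^ n : ℝ) : ℂ)⁻¹ *
    ∫ p : EuclideanSpace ℝ (Fin n),
      Complex.exp (Complex.I * ((inner ℝ p v : ℝ) : ℂ)) * (g (x, p) : ℂ)

/-- The Weyl kernel of a phase-space function `g`:
`K(x,y) = ℏ⁻ⁿ ǧ((x+y)/2, (x−y)/ℏ)`. -/
noncomputable def weylKernelOf {n : ℕ} (ℏ : ℝ)
    (g : EuclideanSpace ℝ (Fin n) × EuclideanSpace ℝ (Fin n) → ℝ)
    (x y : EuclideanSpace ℝ (Fin n)) : ℂ :=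
  ((ℏ : ℂ) ^ n)⁻¹ * partialFourier g ((2 : ℝ)⁻¹ • (x + y)) (ℏ⁻¹ • (x - y))

section helpers

/-- Coherent state centred at `w = (q, r)`. -/
noncomputable def cohState {n : ℕ} (ℏ : ℝ)
    (w : EuclideanSpace ℝ (Fin n) × EuclideanSpace ℝ (Fin n))
    (x : EuclideanSpace ℝ (Fin n)) : ℂ :=
  Complex.exp (Complex.I * ((inner ℝ w.2 x / ℏ : ℝ) : ℂ) + ((-‖x - w.1‖ ^ 2 / (2 * ℏ) : ℝ) : ℂ))

lemma cohState_continuous {n : ℕ} (ℏ : ℝ) :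
    Continuous (fun z : (EuclideanSpace ℝ (Fin n) × EuclideanSpace ℝ (Fin n)) ×
      EuclideanSpace ℝ (Fin n) => conj (cohState ℏ z.1 z.2)) := by
  unfold cohState
  fun_prop

lemma norm_cohState {n : ℕ} (ℏ : ℝ)
    (w : EuclideanSpace ℝ (Fin n) × EuclideanSpace ℝ (Fin n))
    (x : EuclideanSpace ℝ (Fin n)) :
    ‖cohState ℏ w x‖ = Real.exp (-‖x - w.1‖ ^ 2 / (2 * ℏ)) := by
  unfold cohState
  rw [Complex.norm_exp]
  congr 1
  rw [Complex.add_re, Complex.re_mul_ofReal, Complex.ofReal_re]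
  simp

lemma norm_cohState_sq {n : ℕ} (ℏ : ℝ) (hℏ : 0 < ℏ)
    (w : EuclideanSpace ℝ (Fin n) × EuclideanSpace ℝ (Fin n))
    (x : EuclideanSpace ℝ (Fin n)) :
    ‖cohState ℏ w x‖ ^ 2 = Real.exp (-‖x - w.1‖ ^ 2 / ℏ) := by
  rw [norm_cohState, ← Real.exp_nat_mul]
  congr 1
  field_simp
  norm_num
  ring

lemma integrable_gauss {n : ℕ} (ℏ : ℝ) (hℏ : 0 < ℏ) :
    Integrable (fun x : EuclideanSpace ℝ (Fin n) => Real.exp (-‖x‖ ^ 2 / ℏ)) := by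
  have hb : 0 < ((ℏ⁻¹ : ℝ) : ℂ).re := by rw [Complex.ofReal_re]; positivity
  have h := (GaussianFourier.integrable_cexp_neg_mul_sq_norm_add hb 0
    (0 : EuclideanSpace ℝ (Fin n))).norm
  refine h.congr (Filter.Eventually.of_forall fun x => ?_)
  have e : (-((ℏ⁻¹ : ℝ) : ℂ) * (‖x‖ : ℂ) ^ 2 + 0 * ((inner ℝ (0 : EuclideanSpace ℝ (Fin n)) x : ℝ) : ℂ))
      = ((-‖x‖ ^ 2 / ℏ : ℝ) : ℂ) := by
    push_cast; ring
  simp only [e, Complex.norm_exp, Complex.ofReal_re]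

lemma gauss_fourier {n : ℕ} (ℏ : ℝ) (hℏ : 0 < ℏ) :
    ∃ D : ℝ, 0 ≤ D ∧ ∀ (x y : EuclideanSpace ℝ (Fin n))
      (w : EuclideanSpace ℝ (Fin n) × EuclideanSpace ℝ (Fin n)),
      ∫ p : EuclideanSpace ℝ (Fin n),
        Complex.exp (Complex.I * ((inner ℝ p (ℏ⁻¹ • (x - y)) : ℝ) : ℂ)) *
          (gaussianWigner n ℏ (((2 : ℝ)⁻¹ • (x + y), p) - w) : ℂ)
        = D * (cohState ℏ w x * conj (cohState ℏ w y)) := by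
  refine ⟨(2 / ℏ) ^ n * (Real.pi / ℏ⁻¹) ^ ((Module.finrank ℝ (EuclideanSpace ℝ (Fin n)) : ℝ) / 2),
    by positivity, fun x y w => ?_⟩
  have hb : 0 < ((ℏ⁻¹ : ℝ) : ℂ).re := by rw [Complex.ofReal_re]; positivity
  have h := GaussianFourier.integral_cexp_neg_mul_sq_norm_add hb Complex.I (ℏ⁻¹ • (x - y))
  have hc : (((Real.pi / ℏ⁻¹) ^ ((Module.finrank ℝ (EuclideanSpace ℝ (Fin n)) : ℝ) / 2) : ℝ) : ℂ)
      = ((Real.pi : ℂ) / ((ℏ⁻¹ : ℝ) : ℂ)) ^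
        ((Module.finrank ℝ (EuclideanSpace ℝ (Fin n)) : ℂ) / 2) := by
    rw [Complex.ofReal_cpow (by positivity)]
    push_cast; rfl
  have hpar : ‖(2 : ℝ)⁻¹ • (x + y) - w.1‖ ^ 2 + ‖x - y‖ ^ 2 / 4
      = (‖x - w.1‖ ^ 2 + ‖y - w.1‖ ^ 2) / 2 := by
    have e1 : (2 : ℝ)⁻¹ • (x + y) - w.1 = (2 : ℝ)⁻¹ • ((x - w.1) + (y - w.1)) := by
      module
    have e2 : x - y = (x - w.1) - (y - w.1) := by abel
    have := parallelogram_law_with_norm ℝ (x - w.1) (y - w.1)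
    rw [e1, norm_smul, e2, mul_pow]
    norm_num
    rw [← e2] at this
    linarith
  rw [← integral_add_right_eq_self _ w.2]
  have hfun : ∀ p : EuclideanSpace ℝ (Fin n),
      Complex.exp (Complex.I * ((inner ℝ (p + w.2) (ℏ⁻¹ • (x - y)) : ℝ) : ℂ)) *
          (gaussianWigner n ℏ (((2 : ℝ)⁻¹ • (x + y), p + w.2) - w) : ℂ)
      = (((2 / ℏ) ^ n : ℝ) *
          Complex.exp (((-‖(2 : ℝ)⁻¹ • (x + y) - w.1‖ ^ 2 / ℏ : ℝ) : ℂ)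
            + Complex.I * ((inner ℝ w.2 (ℏ⁻¹ • (x - y)) : ℝ) : ℂ))) *
        Complex.exp (-((ℏ⁻¹ : ℝ) : ℂ) * (‖p‖ : ℂ) ^ 2
          + Complex.I * ((inner ℝ (ℏ⁻¹ • (x - y)) p : ℝ) : ℂ)) := by
    intro p
    unfold gaussianWigner
    simp only [Prod.fst_sub, Prod.snd_sub, add_sub_cancel_right]
    rw [Complex.ofReal_mul, Complex.ofReal_exp, mul_left_comm, mul_assoc, ← Complex.exp_add,
      ← Complex.exp_add, inner_add_left, real_inner_comm p]
    congr 2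
    push_cast
    ring
  simp_rw [hfun]
  rw [integral_const_mul, h, Complex.ofReal_mul, hc]
  have key : Complex.exp (((-‖(2 : ℝ)⁻¹ • (x + y) - w.1‖ ^ 2 / ℏ : ℝ) : ℂ)
            + Complex.I * ((inner ℝ w.2 (ℏ⁻¹ • (x - y)) : ℝ) : ℂ)) *
      Complex.exp (Complex.I ^ 2 * (‖ℏ⁻¹ • (x - y)‖ : ℂ) ^ 2 / (4 * ((ℏ⁻¹ : ℝ) : ℂ)))
      = cohState ℏ w x * conj (cohState ℏ w y) := by
    unfold cohState
    rw [← Complex.exp_conj, ← Complex.exp_add, ← Complex.exp_add]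
    congr 1
    simp only [map_add, map_mul, Complex.conj_I, Complex.conj_ofReal]
    have e : (Complex.I ^ 2 * (‖ℏ⁻¹ • (x - y)‖ : ℂ) ^ 2 / (4 * ((ℏ⁻¹ : ℝ) : ℂ)))
        = ((-(‖x - y‖ ^ 2 / 4) / ℏ : ℝ) : ℂ) := by
      rw [norm_smul, Complex.I_sq, Real.norm_of_nonneg (by positivity)]
      have : (ℏ : ℂ) ≠ 0 := by exact_mod_cast hℏ.ne'
      push_cast
      field_simp
    have e3 : ‖x - y‖ ^ 2 / 4 = (‖x - w.1‖ ^ 2 + ‖y - w.1‖ ^ 2) / 2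
      - ‖(2 : ℝ)⁻¹ • (x + y) - w.1‖ ^ 2 := by linarith
    rw [e, e3, inner_smul_right, inner_sub_right]
    have : (ℏ : ℂ) ≠ 0 := by exact_mod_cast hℏ.ne'
    push_cast
    field_simp
    ring
  rw [← key]
  ring

lemma integrable_prod_of_bound {α β : Type*} [MeasureSpace α] [MeasureSpace β]
    [SFinite (volume : Measure α)] [SFinite (volume : Measure β)]
    {H : α × β → ℂ} (hm : AEStronglyMeasurable H ((volume : Measure α).prod volume))
    (h1 : ∀ w, Integrable (fun p => H (w, p))) {g : α → ℝ} (hg : Integrable g)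
    (hb : ∀ w, ∫ p, ‖H (w, p)‖ ≤ g w) : Integrable H ((volume : Measure α).prod volume) := by
  rw [integrable_prod_iff hm]
  refine ⟨Filter.Eventually.of_forall h1, hg.mono' hm.norm.integral_prod_right' ?_⟩
  refine Filter.Eventually.of_forall fun w => ?_
  rw [Real.norm_of_nonneg (integral_nonneg fun _ => norm_nonneg _)]
  exact hb w

lemma schwartz_integrable {n : ℕ}
    (f : SchwartzMap (EuclideanSpace ℝ (Fin n) × EuclideanSpace ℝ (Fin n)) ℝ) :
    Integrable (fun w => f w) := by
  have : ((volume : Measure (EuclideanSpace ℝ (Fin n))).prod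
    (volume : Measure (EuclideanSpace ℝ (Fin n)))).IsAddHaarMeasure := inferInstance
  rw [Measure.volume_eq_prod]
  exact f.integrable

lemma kernel_formula {n : ℕ} (ℏ : ℝ) (hℏ : 0 < ℏ)
    (f : SchwartzMap (EuclideanSpace ℝ (Fin n) × EuclideanSpace ℝ (Fin n)) ℝ) :
    ∃ C : ℝ, 0 ≤ C ∧ ∀ x y : EuclideanSpace ℝ (Fin n),
      weylKernelOf ℏ (phaseConv (gaussianWigner n ℏ) (fun w => f w)) x y
      = C * ∫ w, (f w : ℂ) * (cohState ℏ w x * conj (cohState ℏ w y)) := by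
  obtain ⟨D, hD, h⟩ := gauss_fourier (n := n) ℏ hℏ
  refine ⟨(ℏ ^ n)⁻¹ * ((2 * Real.pi) ^ n)⁻¹ * D, by positivity, fun x y => ?_⟩
  unfold weylKernelOf partialFourier phaseConv
  set m := (2 : ℝ)⁻¹ • (x + y) with hm
  set v := ℏ⁻¹ • (x - y) with hv
  let H : (EuclideanSpace ℝ (Fin n) × EuclideanSpace ℝ (Fin n)) × EuclideanSpace ℝ (Fin n) → ℂ :=
    fun z => (f z.1 : ℂ) * (Complex.exp (Complex.I * ((inner ℝ z.2 v : ℝ) : ℂ)) *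
      (gaussianWigner n ℏ ((m, z.2) - z.1) : ℂ))
  have hcont : Continuous H := by
    have := f.continuous
    simp only [H]
    unfold gaussianWigner
    fun_prop
  have hnorm : ∀ w p, ‖H (w, p)‖ = ‖f w‖ * gaussianWigner n ℏ ((m, p) - w) := by
    intro w p
    simp only [H, norm_mul, Complex.norm_real]
    rw [mul_comm Complex.I, Complex.norm_exp_ofReal_mul_I, one_mul]
    congr 1
    apply Real.norm_of_nonneg
    unfold gaussianWigner
    positivity
  have hg := integrable_gauss (n := n) ℏ hℏ
  have hle : ∀ w p, ‖H (w, p)‖ ≤ ‖f w‖ * ((2 / ℏ) ^ n * Real.exp (-‖p - w.2‖ ^ 2 / ℏ)) := by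
    intro w p
    rw [hnorm]
    unfold gaussianWigner
    simp only [Prod.fst_sub, Prod.snd_sub]
    gcongr
    linarith [sq_nonneg ‖m - w.1‖]
  have hgi : ∀ w : EuclideanSpace ℝ (Fin n) × EuclideanSpace ℝ (Fin n),
      Integrable (fun p => ‖f w‖ * ((2 / ℏ) ^ n * Real.exp (-‖p - w.2‖ ^ 2 / ℏ))) := fun w =>
    ((hg.comp_sub_right w.2).const_mul _).const_mul _
  have hHi : ∀ w, Integrable (fun p => H (w, p)) := fun w =>
    (hgi w).mono' (by fun_prop) (Filter.Eventually.of_forall fun p => hle w p)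
  have hfi : Integrable (fun w => f w) := schwartz_integrable f
  have hH : Integrable H ((volume : Measure _).prod volume) := by
    refine integrable_prod_of_bound hcont.aestronglyMeasurable hHi
      (g := fun w => ‖f w‖ * ((2 / ℏ) ^ n *
        ∫ p : EuclideanSpace ℝ (Fin n), Real.exp (-‖p‖ ^ 2 / ℏ))) (hfi.norm.mul_const _) ?_
    intro w
    refine (integral_mono (hHi w).norm (hgi w) (hle w)).trans ?_
    rw [integral_const_mul, integral_const_mul,
      integral_sub_right_eq_self (fun p => Real.exp (-‖p‖ ^ 2 / ℏ)) w.2]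
  have hsw : ∫ p : EuclideanSpace ℝ (Fin n), Complex.exp (Complex.I * ((inner ℝ p v : ℝ) : ℂ)) *
      ((∫ w, gaussianWigner n ℏ ((m, p) - w) * f w : ℝ) : ℂ)
      = ∫ w, ∫ p, H (w, p) := by
    rw [integral_integral_swap (f := fun w p => H (w, p)) hH]
    congr 1
    ext p
    rw [← integral_complex_ofReal, ← integral_const_mul]
    congr 1
    ext w
    simp only [H]
    push_cast
    ring
  rw [hsw]
  have hin : ∀ w, ∫ p, H (w, p) = D * ((f w : ℂ) * (cohState ℏ w x * conj (cohState ℏ w y))) := by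
    intro w
    simp only [H]
    rw [integral_const_mul, h x y w]
    ring
  simp_rw [hin]
  rw [integral_const_mul]
  push_cast
  ring

lemma gen_meas {α β : Type*} [MeasurableSpace α] [MeasurableSpace β] (F : α → ℂ) (G : α × β → ℂ)
    (hF : Measurable F) (hG : Measurable G) :
    StronglyMeasurable (fun z : α × (β × β) =>
      F z.1 * (conj (G (z.1, z.2.1)) * G (z.1, z.2.2))) := by
  apply Measurable.stronglyMeasurable
  have hc : Measurable (fun z : ℂ => conj z) := Complex.continuous_conj.measurable
  have h1 : Measurable (fun z : α × (β × β) => G (z.1, z.2.1)) := hG.comp (by fun_prop)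
  have h2 : Measurable (fun z : α × (β × β) => G (z.1, z.2.2)) := hG.comp (by fun_prop)
  have h3 : Measurable (fun z : α × (β × β) => conj (G (z.1, z.2.1))) := hc.comp h1
  have h4 : Measurable (fun z : α × (β × β) => F z.1) := hF.comp measurable_fst
  exact h4.mul (h3.mul h2)

lemma gen_integrable {α β : Type*} [MeasureSpace α] [MeasureSpace β]
    [SFinite (volume : Measure α)] [SFinite (volume : Measure β)] (F : α → ℂ) (G : α × β → ℂ)
    (hF : Measurable F) (hG : Measurable G) (hFi : Integrable F)
    (hGi : ∀ w, Integrable (fun x => G (w, x))) (M : ℝ) (hM : ∀ w, ∫ x, ‖G (w, x)‖ ≤ M) :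
    Integrable (fun z : α × (β × β) =>
      F z.1 * (conj (G (z.1, z.2.1)) * G (z.1, z.2.2))) ((volume : Measure α).prod volume) := by
  have hGi' : ∀ w, Integrable (fun x => conj (G (w, x))) := fun w =>
    (hGi w).mono ((Complex.continuous_conj.comp_aestronglyMeasurable
      (hGi w).aestronglyMeasurable)) (Filter.Eventually.of_forall fun x => by simp)
  refine integrable_prod_of_bound (gen_meas F G hF hG).aestronglyMeasurable
    (fun w => ((hGi' w).mul_prod (hGi w)).const_mul (F w))
    (g := fun w => ‖F w‖ * (M * M)) (hFi.norm.mul_const _) ?_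
  intro w
  have e : ∫ p : β × β, ‖F w * (conj (G (w, p.1)) * G (w, p.2))‖
      = ‖F w‖ * ((∫ x, ‖G (w, x)‖) * ∫ x, ‖G (w, x)‖) := by
    rw [← integral_prod_mul (fun x => ‖G (w, x)‖) (fun x => ‖G (w, x)‖), ← integral_const_mul,
      Measure.volume_eq_prod]
    simp only [norm_mul, RCLike.norm_conj]
  refine e.le.trans ?_
  have h0 : 0 ≤ ∫ x, ‖G (w, x)‖ := integral_nonneg fun _ => norm_nonneg _
  have hMw := hM w
  have hM0 : 0 ≤ M := h0.trans hMw
  gcongr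

lemma gen_formula {α β : Type*} [MeasureSpace α] [MeasureSpace β]
    [SFinite (volume : Measure α)] [SFinite (volume : Measure β)] (F : α → ℂ) (G : α × β → ℂ)
    (hF : Measurable F) (hG : Measurable G) (hFi : Integrable F)
    (hGi : ∀ w, Integrable (fun x => G (w, x))) (M : ℝ) (hM : ∀ w, ∫ x, ‖G (w, x)‖ ≤ M) :
    ∫ x, ∫ y, ∫ w, F w * (conj (G (w, x)) * G (w, y))
      = ∫ w, F w * ((‖∫ x, G (w, x)‖ ^ 2 : ℝ) : ℂ) := by
  have hH := gen_integrable F G hF hG hFi hGi M hM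
  have s0 := integral_prod _ hH.integral_prod_right
  rw [← s0]
  have s1 := integral_integral_swap
    (f := fun (w : α) (z : β × β) => F w * (conj (G (w, z.1)) * G (w, z.2))) hH
  refine s1.symm.trans ?_
  congr 1
  ext w
  rw [integral_const_mul, Measure.volume_eq_prod,
    integral_prod_mul (fun x => conj (G (w, x))) (fun x => G (w, x)), integral_conj,
    RCLike.conj_mul]
  push_cast
  rfl

lemma form_formula {n : ℕ} (ℏ : ℝ) (hℏ : 0 < ℏ) (C : ℝ)
    (f : SchwartzMap (EuclideanSpace ℝ (Fin n) × EuclideanSpace ℝ (Fin n)) ℝ)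
    (ψ : EuclideanSpace ℝ (Fin n) → ℂ) (hψm : StronglyMeasurable (fun x => ψ x))
    (hψ2 : Integrable (fun x => ‖ψ x‖ ^ 2)) :
    (∫ x : EuclideanSpace ℝ (Fin n), conj (ψ x) *
            ∫ y : EuclideanSpace ℝ (Fin n),
              ((C : ℂ) * ∫ w, (f w : ℂ) * (cohState ℏ w x * conj (cohState ℏ w y))) * ψ y)
      = ((C * ∫ w, f w * ‖∫ x, conj (cohState ℏ w x) * ψ x‖ ^ 2 : ℝ) : ℂ) := by
  have hg := integrable_gauss (n := n) ℏ hℏ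
  have hφc : ∀ w, Continuous (fun x => conj (cohState (n := n) ℏ w x)) := by
    intro w
    unfold cohState
    fun_prop
  have hbd : ∀ (w : EuclideanSpace ℝ (Fin n) × EuclideanSpace ℝ (Fin n)) (x),
      ‖conj (cohState ℏ w x) * ψ x‖ ≤ ‖ψ x‖ ^ 2 + Real.exp (-‖x - w.1‖ ^ 2 / ℏ) := by
    intro w x
    rw [← norm_cohState_sq ℏ hℏ w x, norm_mul, RCLike.norm_conj]
    nlinarith [sq_nonneg (‖cohState ℏ w x‖ - ‖ψ x‖), sq_nonneg (‖cohState ℏ w x‖),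
      sq_nonneg (‖ψ x‖)]
  have hbi : ∀ (w : EuclideanSpace ℝ (Fin n) × EuclideanSpace ℝ (Fin n)),
      Integrable (fun x => ‖ψ x‖ ^ 2 + Real.exp (-‖x - w.1‖ ^ 2 / ℏ)) := fun w =>
    hψ2.add (hg.comp_sub_right w.1)
  have hai : ∀ w, Integrable (fun x => conj (cohState ℏ w x) * ψ x) := fun w =>
    (hbi w).mono' ((hφc w).aestronglyMeasurable.mul
      hψm.aestronglyMeasurable) (Filter.Eventually.of_forall (hbd w))
  set M : ℝ := (∫ x, ‖ψ x‖ ^ 2) + ∫ x : EuclideanSpace ℝ (Fin n), Real.exp (-‖x‖ ^ 2 / ℏ) with hM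
  have hMb : ∀ w, ∫ x, ‖conj (cohState ℏ w x) * ψ x‖ ≤ M := by
    intro w
    refine (integral_mono (hai w).norm (hbi w) (hbd w)).trans ?_
    rw [integral_add hψ2 (hg.comp_sub_right w.1),
      integral_sub_right_eq_self (fun p => Real.exp (-‖p‖ ^ 2 / ℏ)) w.1]
  have hfi : Integrable (fun w => f w) := schwartz_integrable f
  have hF : Measurable (fun w => (f w : ℂ)) := by
    have := f.continuous
    exact Continuous.measurable (by fun_prop)
  have hG : Measurable (fun z : (EuclideanSpace ℝ (Fin n) × EuclideanSpace ℝ (Fin n)) ×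
      EuclideanSpace ℝ (Fin n) => conj (cohState ℏ z.1 z.2) * ψ z.2) := by
    have c0 := (cohState_continuous (n := n) ℏ).measurable
    exact c0.mul (hψm.measurable.comp measurable_snd)
  have key := gen_formula (fun w => (f w : ℂ)) (fun z => conj (cohState ℏ z.1 z.2) * ψ z.2)
    hF hG hfi.ofReal hai M hMb
  rw [Complex.ofReal_mul, ← integral_complex_ofReal]
  simp only [Complex.ofReal_mul]
  rw [← key, ← integral_const_mul]
  congr 1
  ext x
  rw [← integral_const_mul, ← integral_const_mul]
  congr 1
  ext y
  rw [mul_assoc, mul_left_comm, ← integral_mul_const, ← integral_const_mul]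
  congr 2
  ext w
  simp only [map_mul, Complex.conj_conj]
  ring

end helpers

set_option maxHeartbeats 400000 in
/-- Positivity of the smeared quantization: for `ℏ > 0` and a nonnegative Schwartz
function `f` on phase space, the operator `Q_ℏ^Ω(f) = Q_ℏ(W_ℏ ∗ f)` is positive on
`L²(ℝⁿ)`: `⟨Q_ℏ(W_ℏ ∗ f)ψ, ψ⟩ ≥ 0` (in particular it is real) for every `ψ ∈ L²`. -/
theorem smeared_quantization_positive {n : ℕ} (ℏ : ℝ) (hℏ : 0 < ℏ)
    (f : SchwartzMap (EuclideanSpace ℝ (Fin n) × EuclideanSpace ℝ (Fin n)) ℝ)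
    (hf : ∀ z, 0 ≤ f z)
    (ψ : Lp ℂ 2 (volume : Measure (EuclideanSpace ℝ (Fin n)))) :
    0 ≤ (∫ x : EuclideanSpace ℝ (Fin n),
          conj (ψ x) *
            ∫ y : EuclideanSpace ℝ (Fin n),
              weylKernelOf ℏ (phaseConv (gaussianWigner n ℏ) (fun w => f w)) x y * ψ y).re
    ∧ (∫ x : EuclideanSpace ℝ (Fin n),
          conj (ψ x) *
            ∫ y : EuclideanSpace ℝ (Fin n),
              weylKernelOf ℏ (phaseConv (gaussianWigner n ℏ) (fun w => f w)) x y * ψ y).im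
        = 0 := by
  obtain ⟨C, hC, hK⟩ := kernel_formula ℏ hℏ f
  simp_rw [hK]
  have hψm : StronglyMeasurable (fun x => ψ x) := Lp.stronglyMeasurable ψ
  have hψ2 : Integrable (fun x => ‖ψ x‖ ^ 2) := (Lp.memLp ψ).integrable_norm_pow (by norm_num)
  rw [form_formula ℏ hℏ C f (fun x => ψ x) hψm hψ2]
  refine ⟨?_, Complex.ofReal_im _⟩
  rw [Complex.ofReal_re]
  exact mul_nonneg hC (integral_nonneg fun w => mul_nonneg (hf w) (by positivity))
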